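/- For integers n and i with 1 ≤ i < n/3, b(n,i) = a(n,i) − Σ_{m = max(2i, 1+⌊(n+i)/3⌋)}^{⌊(n+i−1)/2⌋} e(m−i, i, n+i−2m). -/

import Mathlib

/-- `listPow Y k` is the sequence `Y` repeated `k` times (i.e. `Y^k`). -/
def listPow {α : Type*} (Y : List α) : ℕ → List α
  | 0 => []
  | k + 1 => Y ++ listPow Y k

/-- The curling number of a finite sequence `S`: the largest `k` such that
`S = X ++ Y^k` for some (possibly empty) `X` and nonempty `Y`. -/
noncomputable def CN {α : Type*} (S : List α) : ℕ :=
  sSup {k | ∃ X Y : List α, Y ≠ [] ∧ S = X ++ listPow Y k}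

/-- A nonempty sequence is primitive if it is not a power `T^i` with `i ≥ 2`. -/
def Primitive {α : Type*} (S : List α) : Prop :=
  S ≠ [] ∧ ∀ (T : List α) (i : ℕ), 2 ≤ i → S ≠ listPow T i

/-- `T` is a proper suffix of `S`: a suffix which is strictly shorter than `S`. -/
def ProperSuffix {α : Type*} (T S : List α) : Prop := T <:+ S ∧ T.length < S.length

/-- A sequence `S` with curling number `k` is robust if no proper suffix of
`S^(k+1)` has curling number `≥ k + 1`. -/
def Robust {α : Type*} (S : List α) : Prop :=
  ∀ T : List α, ProperSuffix T (listPow S (CN S + 1)) → CN T ≤ CN S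

/-- `c(n,k)`: the number of binary sequences of length `n` with curling number `k`. -/
noncomputable def cCount (n k : ℕ) : ℕ :=
  {S : List Bool | S.length = n ∧ CN S = k}.ncard

/-- `p(n,k)`: the number of primitive binary sequences of length `n` with curling number `k`. -/
noncomputable def pCount (n k : ℕ) : ℕ :=
  {S : List Bool | S.length = n ∧ CN S = k ∧ Primitive S}.ncard

/-- `p'(n,k)`: the number of primitive robust binary sequences of length `n`
with curling number `k`. -/
noncomputable def pCount' (n k : ℕ) : ℕ :=
  {S : List Bool | S.length = n ∧ CN S = k ∧ Primitive S ∧ Robust S}.ncard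

/-- `q(n,k) = Σ_{i=1}^{k} p(n,i)`. -/
noncomputable def qCount (n k : ℕ) : ℕ := ∑ i ∈ Finset.Icc 1 k, pCount n i

/-- `S^{[i]}`: the suffix of `S` of length `i`. -/
def suffLen {α : Type*} (S : List α) (i : ℕ) : List α := S.drop (S.length - i)

/-- `A(n,i)`: binary sequences `S` of length `n` with `CN S = 1` and `CN (S^{[i]} S) = 1`. -/
def setA (n i : ℕ) : Set (List Bool) :=
  {S | S.length = n ∧ CN S = 1 ∧ CN (suffLen S i ++ S) = 1}

/-- `B(n,i)`: binary sequences `S` of length `n` with `CN S = 1` and `CN (S S^{[i]} S) = 1`. -/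
def setB (n i : ℕ) : Set (List Bool) :=
  {S | S.length = n ∧ CN S = 1 ∧ CN (S ++ suffLen S i ++ S) = 1}

/-- `E(n,i,j)`: binary sequences `S` of length `n` with `CN S = 1`
and `S^{[i]} S ∈ B(n+i, j)`. -/
def setE (n i j : ℕ) : Set (List Bool) :=
  {S | S.length = n ∧ CN S = 1 ∧ (suffLen S i ++ S) ∈ setB (n + i) j}

noncomputable def aCount (n i : ℕ) : ℕ := (setA n i).ncard
noncomputable def bCount (n i : ℕ) : ℕ := (setB n i).ncard
noncomputable def eCount (n i j : ℕ) : ℕ := (setE n i j).ncard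

theorem length_listPow {α : Type*} (Y : List α) (k : ℕ) :
    (listPow Y k).length = k * Y.length := by
  induction k with
  | zero => simp [listPow]
  | succ k ih => simp only [listPow, List.length_append, ih]; ring

/-- The exponents `k` in factorizations `S = X Y^k` are bounded by the length of `S`. -/
theorem exponent_le_length {α : Type*} {S X Y : List α} {k : ℕ} (hY : Y ≠ [])
    (h : S = X ++ listPow Y k) : k ≤ S.length := by
  have hpos := List.length_pos_iff.2 hY
  rw [h, List.length_append, length_listPow]
  nlinarith

/-- `S` has no suffix of the form `Y Y` with `Y` nonempty. -/
def NoSquareSuffix {α : Type*} (S : List α) : Prop :=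
  ∀ Y : List α, Y ++ Y <:+ S → Y = []

theorem NoSquareSuffix.of_suffix {α : Type*} {S T : List α} (hS : NoSquareSuffix S)
    (h : T <:+ S) : NoSquareSuffix T :=
  fun Y hY => hS Y (hY.trans h)

theorem listPow_two_suffix {α : Type*} (Y : List α) (k : ℕ) :
    Y ++ Y <:+ listPow Y (k + 2) := by
  induction k with
  | zero => simp [listPow]
  | succ k ih => exact ih.trans (List.suffix_append _ _)

theorem CN_eq_one_iff {α : Type*} (S : List α) :
    CN S = 1 ↔ S ≠ [] ∧ NoSquareSuffix S := by
  have hbdd : BddAbove {k | ∃ X Y : List α, Y ≠ [] ∧ S = X ++ listPow Y k} :=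
    ⟨S.length, fun k ⟨_, _, hY, h⟩ => exponent_le_length hY h⟩
  constructor
  · intro h
    constructor
    · rintro rfl
      have : CN ([] : List α) ≤ 0 :=
        csSup_le' fun k ⟨_, _, hY, h⟩ => exponent_le_length hY h
      omega
    · rintro Y ⟨X, hX⟩
      by_contra hY
      have : 2 ≤ CN S := le_csSup hbdd ⟨X, Y, hY, by simp [listPow, ← hX]⟩
      omega
  · rintro ⟨hne, hsq⟩
    apply le_antisymm
    · apply csSup_le'
      rintro k ⟨X, Y, hY, h⟩
      by_contra! hk
      obtain ⟨l, rfl⟩ := Nat.exists_eq_add_of_le' (show 2 ≤ k from hk)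
      exact hY (hsq Y ((listPow_two_suffix Y l).trans ⟨X, h.symm⟩))
    · exact le_csSup hbdd ⟨[], S, hne, by simp [listPow]⟩

theorem suffLen_suffix {α : Type*} (S : List α) (i : ℕ) : suffLen S i <:+ S :=
  List.drop_suffix _ _

theorem length_suffLen {α : Type*} {S : List α} {i : ℕ} (h : i ≤ S.length) :
    (suffLen S i).length = i := by
  simp only [suffLen, List.length_drop]
  omega

theorem suffLen_eq_of_suffix {α : Type*} {S T : List α} {i : ℕ} (h : T <:+ S)
    (hi : T.length = i) : suffLen S i = T := by
  obtain ⟨X, rfl⟩ := h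
  simp [suffLen, ← hi]

/-- A border covering at least half of a sequence forces a square suffix. -/
theorem NoSquareSuffix.eq_of_border {α : Type*} {Q B : List α} (hQ : NoSquareSuffix Q)
    (hpre : B <+: Q) (hsuf : B <:+ Q) (hlen : Q.length ≤ 2 * B.length) : B = Q := by
  obtain ⟨X, rfl⟩ := hpre
  rw [List.length_append] at hlen
  have hX : X <:+ B :=
    List.suffix_of_suffix_length_le (List.suffix_append B X) hsuf (by omega)
  have := hQ X (List.suffix_append_self_iff.2 hX)
  simp [this]

/-- The sequence `S` with `S^{[i]} S = Q Q^{[j]} Q`, where `Q = R^{[i]} R`. -/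
def extend {α : Type*} (i j : ℕ) (R : List α) : List α :=
  R ++ (suffLen (suffLen R i ++ R) j ++ (suffLen R i ++ R))

theorem suffLen_extend {α : Type*} {i : ℕ} (j : ℕ) {R : List α} (h : i ≤ R.length) :
    suffLen (extend i j R) i = suffLen R i := by
  apply suffLen_eq_of_suffix _ (length_suffLen h)
  exact (suffLen_suffix R i).trans
    ((List.suffix_append _ _).trans ((List.suffix_append _ _).trans (List.suffix_append _ _)))

theorem suffLen_append_extend {α : Type*} {i : ℕ} (j : ℕ) {R : List α} (h : i ≤ R.length) :
    suffLen (extend i j R) i ++ extend i j R =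
      (suffLen R i ++ R) ++ suffLen (suffLen R i ++ R) j ++ (suffLen R i ++ R) := by
  rw [suffLen_extend j h]
  simp [extend]

theorem setA_finite (n i : ℕ) : (setA n i).Finite :=
  (List.finite_length_eq Bool n).subset fun _ h => h.1

theorem setE_finite (n i j : ℕ) : (setE n i j).Finite :=
  (List.finite_length_eq Bool n).subset fun _ h => h.1

theorem setB_subset_setA (n i : ℕ) : setB n i ⊆ setA n i := by
  rintro S ⟨hn, h1, h2⟩
  refine ⟨hn, h1, ?_⟩
  rw [CN_eq_one_iff] at *
  refine ⟨by simp [h1.1], h2.2.of_suffix ?_⟩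
  rw [List.append_assoc]
  exact List.suffix_append _ _

theorem extend_mem_diff {n i m : ℕ} (hi : 1 ≤ i) (hm : 2 * i ≤ m)
    (hm3 : n + i < 3 * m) (hm2 : 2 * m < n + i) {R : List Bool}
    (hR : R ∈ setE (m - i) i (n + i - 2 * m)) :
    extend i (n + i - 2 * m) R ∈ setA n i \ setB n i := by
  obtain ⟨hlen, -, hQlen, -, hQ⟩ := hR
  have hiR : i ≤ R.length := by omega
  rw [← suffLen_append_extend _ hiR] at hQ
  have hl : (suffLen (suffLen R i ++ R) (n + i - 2 * m)).length = n + i - 2 * m :=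
    length_suffLen (by omega)
  have hSlen : (extend i (n + i - 2 * m) R).length = n := by
    simp only [extend, List.length_append, hl, length_suffLen hiR]
    omega
  refine ⟨⟨hSlen, ?_, hQ⟩, ?_⟩
  · rw [CN_eq_one_iff] at hQ ⊢
    refine ⟨fun h => ?_, hQ.2.of_suffix (List.suffix_append _ _)⟩
    rw [h] at hSlen
    simp at hSlen
    omega
  · rintro ⟨-, -, hB⟩
    rw [List.append_assoc, suffLen_append_extend _ hiR, CN_eq_one_iff] at hB
    generalize hM : suffLen (suffLen R i ++ R) (n + i - 2 * m) = M at *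
    have hMS : M <:+ extend i (n + i - 2 * m) R := by
      rw [← hM]
      exact (suffLen_suffix _ _).trans
        ((List.suffix_append _ _).trans (List.suffix_append _ _))
    have := hB.2 (M ++ (suffLen R i ++ R)) (by
      obtain ⟨Z, hZ⟩ := hMS
      rw [← hZ]
      exact ⟨Z, by simp⟩)
    have := congrArg List.length this
    simp only [List.length_append, List.length_nil] at this
    omega

theorem exists_extend_eq {n i : ℕ} (hi : 1 ≤ i) (hn : 3 * i < n) {S : List Bool}
    (hS : S ∈ setA n i \ setB n i) :
    ∃ m, 2 * i ≤ m ∧ n + i < 3 * m ∧ 2 * m < n + i ∧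
      ∃ R ∈ setE (m - i) i (n + i - 2 * m), extend i (n + i - 2 * m) R = S := by
  obtain ⟨⟨hlen, hS1, hA⟩, hB⟩ := hS
  have hTlen : (suffLen S i).length = i := length_suffLen (by omega)
  have hTS : suffLen S i <:+ S := suffLen_suffix S i
  have hB' : ¬ CN (S ++ suffLen S i ++ S) = 1 := fun h => hB ⟨hlen, hS1, h⟩
  generalize hT : suffLen S i = T at *
  rw [List.append_assoc, CN_eq_one_iff] at hB'
  rw [CN_eq_one_iff] at hA hS1
  obtain ⟨-, hA⟩ := hA
  have hWlen : (T ++ S).length = n + i := by simp only [List.length_append]; omega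
  obtain ⟨Y, hY, hY0⟩ : ∃ Y, Y ++ Y <:+ S ++ (T ++ S) ∧ Y ≠ [] := by
    by_contra! h
    exact hB' ⟨by simp [hS1.1], h⟩
  have hYlen := hY.length_le
  simp only [List.length_append] at hYlen
  have hlong : n + i < 2 * Y.length := by
    by_contra! h
    exact hY0 (hA Y (List.suffix_of_suffix_length_le hY (List.suffix_append _ _)
      (by simp only [List.length_append]; omega)))
  obtain ⟨Q, hQ⟩ : Y <:+ T ++ S :=
    List.suffix_of_suffix_length_le ((List.suffix_append Y Y).trans hY)
      (List.suffix_append _ _) (by omega)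
  have hQlen := congrArg List.length hQ
  rw [hWlen, List.length_append] at hQlen
  rw [← hQ, ← List.append_assoc] at hY
  have hY' : Y <:+ S ++ Q := by
    obtain ⟨Z, hZ⟩ := hY
    rw [← List.append_assoc] at hZ
    exact ⟨Z, List.append_cancel_right hZ⟩
  obtain ⟨M, rfl⟩ : Q <:+ Y :=
    List.suffix_of_suffix_length_le (List.suffix_append _ _) hY' (by omega)
  have hMS : M <:+ S := by
    obtain ⟨Z, hZ⟩ := hY'
    rw [← List.append_assoc] at hZ
    exact ⟨Z, List.append_cancel_right hZ⟩
  have hSW : S <:+ T ++ S := List.suffix_append _ _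
  have hQW : Q <:+ T ++ S := hQ ▸ (List.suffix_append _ _).trans (List.suffix_append _ _)
  simp only [List.length_append] at *
  have hMQ : M.length < Q.length := by
    by_contra! h
    obtain ⟨Z, rfl⟩ : Q <:+ M :=
      List.suffix_of_suffix_length_le hQW (hMS.trans hSW) h
    have := hA Q (hQ ▸ ⟨Q ++ Z, by simp⟩)
    simp only [this, List.length_nil] at *
    omega
  have hMsQ : M <:+ Q :=
    List.suffix_of_suffix_length_le (hMS.trans hSW) hQW hMQ.le
  have hTsQ : T <:+ Q :=
    List.suffix_of_suffix_length_le (hTS.trans hSW) hQW (by omega)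
  obtain ⟨R, rfl⟩ : T <+: Q :=
    List.prefix_of_prefix_length_le (List.prefix_append T S)
      (hQ ▸ List.prefix_append _ _) (by omega)
  simp only [List.length_append] at *
  have h2i : i ≤ R.length := by
    by_contra! h
    have := congrArg List.length ((hA.of_suffix hQW).eq_of_border
      (List.prefix_append T R) hTsQ (by simp only [List.length_append]; omega))
    simp only [List.length_append] at this
    omega
  have hTR : suffLen R i = T :=
    suffLen_eq_of_suffix
      (List.suffix_of_suffix_length_le hTsQ (List.suffix_append _ _) (by omega)) hTlen
  have hM : suffLen (T ++ R) (n + i - 2 * (i + R.length)) = M :=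
    suffLen_eq_of_suffix hMsQ (by omega)
  have hRne : R ≠ [] := List.length_pos_iff.1 (by omega)
  refine ⟨i + R.length, by omega, by omega, by omega, R, ⟨by omega, ?_, ?_⟩, ?_⟩
  · exact (CN_eq_one_iff R).2 ⟨hRne, hA.of_suffix ((List.suffix_append _ _).trans hQW)⟩
  · rw [hTR]
    refine ⟨by simp only [List.length_append]; omega, ?_, ?_⟩
    · exact (CN_eq_one_iff _).2 ⟨by simp [hRne], hA.of_suffix hQW⟩
    · rw [hM, List.append_assoc, hQ]
      exact (CN_eq_one_iff _).2 ⟨by simp [hS1.1], hA⟩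
  · rw [extend, hTR, hM]
    apply List.append_cancel_left (as := T)
    rw [← hQ]
    simp

theorem length_le_of_extend_eq {n i m m' : ℕ} (hm : 2 * i ≤ m) (hm3 : n + i < 3 * m)
    (hm' : 2 * i ≤ m') (hm2' : 2 * m' < n + i) {R R' : List Bool}
    (hR : R ∈ setE (m - i) i (n + i - 2 * m)) (hR' : R' ∈ setE (m' - i) i (n + i - 2 * m'))
    (h : extend i (n + i - 2 * m) R = extend i (n + i - 2 * m') R') : m' ≤ m := by
  by_contra! hlt
  obtain ⟨hlen, -, hQlen, -, -⟩ := hR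
  obtain ⟨hlen', -, hQlen', hQ', -⟩ := hR'
  have h1 := suffLen_append_extend (n + i - 2 * m) (show i ≤ R.length by omega)
  rw [h, suffLen_append_extend (n + i - 2 * m') (show i ≤ R'.length by omega)] at h1
  rw [CN_eq_one_iff] at hQ'
  generalize suffLen R i ++ R = Q at *
  generalize suffLen R' i ++ R' = Q' at *
  have hpre : Q <+: Q' := by
    refine List.prefix_of_prefix_length_le (l₃ := Q ++ suffLen Q (n + i - 2 * m) ++ Q)
      ?_ ?_ (by omega)
    · exact (List.prefix_append _ _).trans (List.prefix_append _ _)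
    · exact h1 ▸ (List.prefix_append _ _).trans (List.prefix_append _ _)
  have hsuf : Q <:+ Q' :=
    List.suffix_of_suffix_length_le (List.suffix_append _ _) (h1 ▸ List.suffix_append _ _)
      (by omega)
  have := congrArg List.length (hQ'.2.eq_of_border hpre hsuf (by omega))
  omega

theorem extend_injOn (k i j : ℕ) : Set.InjOn (extend i j) (setE k i j) := by
  intro R hR R' hR' h
  exact (List.append_inj h (hR.1.trans hR'.1.symm)).1

/-- For `1 ≤ i < n/3`:
`b(n,i) = a(n,i) - Σ_{m = max(2i, 1+⌊(n+i)/3⌋)}^{⌊(n+i-1)/2⌋} e(m-i, i, n+i-2m)`. -/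
theorem bCount_formula (n i : ℕ) (h1 : 1 ≤ i) (h2 : 3 * i < n) :
    (bCount n i : ℤ) = (aCount n i : ℤ) -
      ∑ m ∈ Finset.Icc (max (2 * i) ((n + i) / 3 + 1)) ((n + i - 1) / 2),
        (eCount (m - i) i (n + i - 2 * m) : ℤ) := by
  set I := Finset.Icc (max (2 * i) ((n + i) / 3 + 1)) ((n + i - 1) / 2) with hI
  have hmem : ∀ m, m ∈ I ↔ 2 * i ≤ m ∧ n + i < 3 * m ∧ 2 * m < n + i := by
    intro m
    rw [hI, Finset.mem_Icc, max_le_iff]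
    omega
  have hdiff : setA n i \ setB n i =
      ⋃ m ∈ I, extend i (n + i - 2 * m) '' setE (m - i) i (n + i - 2 * m) := by
    ext S
    simp only [Set.mem_iUnion, exists_prop]
    constructor
    · intro hS
      obtain ⟨m, hm, hm3, hm2, R, hR, h⟩ := exists_extend_eq h1 h2 hS
      exact ⟨m, (hmem m).2 ⟨hm, hm3, hm2⟩, R, hR, h⟩
    · rintro ⟨m, hm, R, hR, rfl⟩
      obtain ⟨hm, hm3, hm2⟩ := (hmem m).1 hm
      exact extend_mem_diff h1 hm hm3 hm2 hR
  have hcard : (setA n i \ setB n i).ncard = ∑ m ∈ I, eCount (m - i) i (n + i - 2 * m) := by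
    rw [hdiff, ← Finset.set_biUnion_coe, I.finite_toSet.ncard_biUnion, finsum_mem_coe_finset]
    · exact Finset.sum_congr rfl fun m _ => (extend_injOn _ _ _).ncard_image
    · exact fun m _ => (setE_finite _ _ _).image _
    · intro m hm m' hm' hne
      rw [Function.onFun, Set.disjoint_left]
      rintro _ ⟨R, hR, rfl⟩ ⟨R', hR', h⟩
      obtain ⟨hm, hm3, hm2⟩ := (hmem m).1 hm
      obtain ⟨hm', hm3', hm2'⟩ := (hmem m').1 hm'
      exact hne (le_antisymm (length_le_of_extend_eq hm' hm3' hm hm2 hR' hR h)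
        (length_le_of_extend_eq hm hm3 hm' hm2' hR hR' h.symm))
  have hsub := Set.ncard_sdiff_add_ncard_of_subset (setB_subset_setA n i) (setA_finite n i)
  rw [hcard] at hsub
  simp only [bCount, aCount, ← hsub]
  push_cast
  ring
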